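/- arXiv:1112.4726 — 4 statements merged into one kernel-verified Lean document; each statement's English description precedes it below -/
import Mathlib

section
/- Let m ≥ 6 be an even integer and τ ∈ ℍ. Define D̃₄(τ) := 2^m η(2τ)^{2m}/η(τ)^{m+12} and D̃₂(τ) := 2^m η(2τ)^{2m}/η(τ)^{m+12} · ( (−m/24 − 1/6) E₂(τ) + (m/6) E₂(2τ) ). Then the function ε ↦ ϑ(ε + 1/2; τ)^m/ϑ(ε; τ)^4 − D̃₄(τ)/(2πiε)^4 − D̃₂(τ)/(2πiε)² is bounded in a punctured neighborhood of ε = 0; that is, the Laurent expansion of ϑ(ε+1/2;τ)^m/ϑ(ε;τ)^4 at ε = 0 is D̃₄(τ)/(2πiε)^4 + D̃₂(τ)/(2πiε)² + O(1). -/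
open Real

/-- The Jacobi theta function
`ϑ(z;τ) := ∑_{ν ∈ 1/2 + ℤ} e^{πiν²τ + 2πiν(z+1/2)}`, parametrized by `ν = n + 1/2, n ∈ ℤ`. -/
noncomputable def jacobiThetaKW (z τ : ℂ) : ℂ :=
  ∑' n : ℤ, Complex.exp (π * Complex.I * ((n : ℂ) + 1 / 2) ^ 2 * τ +
      2 * π * Complex.I * ((n : ℂ) + 1 / 2) * (z + 1 / 2))

/-- The Dedekind eta function `η(τ) := q^{1/24} ∏_{k=1}^∞ (1 − q^k)`, `q = e^{2πiτ}`. -/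
noncomputable def dedekindEta (τ : ℂ) : ℂ :=
  Complex.exp (π * Complex.I * τ / 12) *
    ∏' k : ℕ, (1 - Complex.exp (2 * π * Complex.I * τ * ((k : ℂ) + 1)))

/-- The quasimodular Eisenstein series `E₂(τ) := 1 − 24 ∑_{k=1}^∞ σ₁(k) q^k`, `q = e^{2πiτ}`. -/
noncomputable def eisensteinE2 (τ : ℂ) : ℂ :=
  1 - 24 * ∑' k : ℕ, ((ArithmeticFunction.sigma 1) (k + 1) : ℂ) *
      Complex.exp (2 * π * Complex.I * τ * ((k : ℂ) + 1))


noncomputable def kwP (q : ℂ) (n : ℕ) : ℂ := ∏ i ∈ Finset.range n, (1 - q ^ (i + 1))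

lemma kw_one_sub_ne {q : ℂ} (hq : ‖q‖ < 1) (i : ℕ) : 1 - q ^ (i + 1) ≠ 0 := by
  intro h
  have h1 : ‖q ^ (i + 1)‖ = 1 := by rw [← sub_eq_zero.mp h]; simp
  have h2 : ‖q ^ (i + 1)‖ < 1 := by
    rw [norm_pow]; exact pow_lt_one₀ (norm_nonneg _) hq (by simp)
  linarith

lemma kwP_ne {q : ℂ} (hq : ‖q‖ < 1) (n : ℕ) : kwP q n ≠ 0 :=
  Finset.prod_ne_zero_iff.mpr fun i _ => kw_one_sub_ne hq i

lemma kwP_succ (q : ℂ) (n : ℕ) : kwP q (n + 1) = kwP q n * (1 - q ^ (n + 1)) :=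
  Finset.prod_range_succ _ _

noncomputable def kwB (q : ℂ) (M j : ℕ) : ℂ :=
  if j ≤ M then kwP q M / (kwP q j * kwP q (M - j)) else 0

lemma kwB_zero {q : ℂ} (hq : ‖q‖ < 1) (M : ℕ) : kwB q M 0 = 1 := by
  simp [kwB, kwP_ne hq M, show kwP q 0 = 1 by simp [kwP]]

lemma kwB_succ {q : ℂ} (hq : ‖q‖ < 1) (M j : ℕ) (hj : j ≤ M) :
    kwB q (M + 1) (j + 1) = kwB q M (j + 1) + q ^ (M - j) * kwB q M j := by
  obtain ⟨d, rfl⟩ := Nat.exists_eq_add_of_le hj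
  have a := kwP_ne hq
  have b := kw_one_sub_ne hq
  rcases d with _ | d
  · simp [kwB, a, show kwP q 0 = 1 by simp [kwP]]
  · have e1 : j + (d + 1) + 1 - (j + 1) = d + 1 := by omega
    have e2 : j + (d + 1) - (j + 1) = d := by omega
    have e3 : j + (d + 1) - j = d + 1 := by omega
    have l1 : j + 1 ≤ j + (d + 1) + 1 := by omega
    have l2 : j + 1 ≤ j + (d + 1) := by omega
    have l3 : j ≤ j + (d + 1) := by omega
    simp only [kwB, e1, e2, e3, l1, l2, l3, if_true, kwP_succ]
    have := a j; have := a d; have := b j; have := b d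
    have := a (j + (d + 1))
    field_simp
    ring

lemma kw_qbinom {q : ℂ} (hq : ‖q‖ < 1) (e : ℕ → ℂ) (e0 : e 0 = 1)
    (e1 : ∀ j, e (j + 1) = e j * q ^ j) (x : ℂ) (M : ℕ) :
    ∏ k ∈ Finset.range M, (1 + x * q ^ k) =
      ∑ j ∈ Finset.range (M + 1), e j * kwB q M j * x ^ j := by
  induction M with
  | zero => simp [e0, kwB_zero hq]
  | succ M ih =>
    rw [Finset.prod_range_succ, ih, Finset.sum_range_succ' _ (M + 1)]
    have h2 : ∑ j ∈ Finset.range (M + 1), e (j + 1) * kwB q (M + 1) (j + 1) * x ^ (j + 1) =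
        ∑ j ∈ Finset.range (M + 1), e (j + 1) * kwB q M (j + 1) * x ^ (j + 1) +
        x * q ^ M * ∑ j ∈ Finset.range (M + 1), e j * kwB q M j * x ^ j := by
      rw [Finset.mul_sum, ← Finset.sum_add_distrib]
      refine Finset.sum_congr rfl fun j hj => ?_
      have hj' : j ≤ M := by simpa [Nat.lt_succ_iff] using hj
      rw [kwB_succ hq M j hj', e1, ← Nat.add_sub_cancel' hj', Nat.add_sub_cancel_left, pow_add q j]
      ring
    rw [h2]
    have h3 := Finset.sum_range_succ' (fun j => e j * kwB q M j * x ^ j) (M + 1)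
    have h4 := Finset.sum_range_succ (fun j => e j * kwB q M j * x ^ j) (M + 1)
    have h5 : kwB q M (M + 1) = 0 := by simp [kwB]
    simp only [h5, mul_zero, zero_mul, add_zero, kwB_zero hq] at h3 h4 ⊢
    rw [h4] at h3
    linear_combination h3

/-- the terms of the bilateral series -/
noncomputable def kwT (τ w : ℂ) (n : ℤ) : ℂ :=
  Complex.exp (π * Complex.I * (n * (n + 1)) * τ + 2 * π * Complex.I * n * w)

lemma kw_finite (τ w : ℂ) (hτ : ‖Complex.exp (2 * π * Complex.I * τ)‖ < 1) (N : ℕ) :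
    (∏ k ∈ Finset.range N,
      (1 + Complex.exp (2 * π * Complex.I * w) * Complex.exp (2 * π * Complex.I * τ) ^ (k + 1))) *
    (∏ k ∈ Finset.range N,
      (1 + (Complex.exp (2 * π * Complex.I * w))⁻¹ * Complex.exp (2 * π * Complex.I * τ) ^ k)) =
    ∑ j ∈ Finset.range (2 * N + 1), kwT τ w ((j : ℤ) - N) *
      kwB (Complex.exp (2 * π * Complex.I * τ)) (2 * N) j := by
  set q := Complex.exp (2 * π * Complex.I * τ) with hq
  set u := Complex.exp (2 * π * Complex.I * w) with hu
  have hu0 : u ≠ 0 := Complex.exp_ne_zero _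
  have hq0 : q ≠ 0 := Complex.exp_ne_zero _
  have key := kw_qbinom hτ (fun j => Complex.exp (π * Complex.I * τ * (j * (j - 1)))) (by simp)
    (by intro j; rw [hq, ← Complex.exp_nat_mul, ← Complex.exp_add]; congr 1; push_cast; ring)
    (Complex.exp (2 * π * Complex.I * (w + (1 - N) * τ))) (2 * N)
  set x := Complex.exp (2 * π * Complex.I * (w + (1 - N) * τ)) with hx
  have hxq : x * q ^ N = u * q := by
    rw [hx, hq, hu, ← Complex.exp_nat_mul, ← Complex.exp_add, ← Complex.exp_add]; congr 1; ring
  set c : ℂ := Complex.exp (π * Complex.I * (2 * N * w - N * (N - 1) * τ)) with hc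
  have hc0 : c ≠ 0 := Complex.exp_ne_zero _
  have h1 : ∏ k ∈ Finset.range (2 * N), (1 + x * q ^ k) = c *
      ((∏ k ∈ Finset.range N, (1 + u * q ^ (k + 1))) *
        (∏ k ∈ Finset.range N, (1 + u⁻¹ * q ^ k))) := by
    rw [two_mul, Finset.prod_range_add]
    have h2 : ∏ k ∈ Finset.range N, (1 + x * q ^ (N + k)) =
        ∏ k ∈ Finset.range N, (1 + u * q ^ (k + 1)) := by
      refine Finset.prod_congr rfl fun k _ => ?_
      rw [pow_add, ← mul_assoc, hxq]; ring
    have h3 : ∏ k ∈ Finset.range N, (1 + x * q ^ k) =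
        c * ∏ k ∈ Finset.range N, (1 + u⁻¹ * q ^ k) := by
      rw [← Finset.prod_range_reflect]
      have h4 : ∀ k ∈ Finset.range N, 1 + x * q ^ (N - 1 - k) =
          (u * (q ^ k)⁻¹) * (1 + u⁻¹ * q ^ k) := by
        intro k hk
        have hk' : N = (N - 1 - k) + k + 1 := by have := Finset.mem_range.mp hk; omega
        have h5 : x * q ^ (N - 1 - k) * q ^ k = u := by
          have : x * q ^ (N - 1 - k) * q ^ k * q = u * q := by
            rw [← hxq, mul_assoc, mul_assoc, ← pow_succ, ← pow_add]
            congr 2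
            omega
          exact mul_right_cancel₀ hq0 this
        have : q ^ k ≠ 0 := pow_ne_zero _ hq0
        field_simp
        linear_combination h5
      rw [Finset.prod_congr rfl h4, Finset.prod_mul_distrib]
      congr 1
      clear_value x
      clear h4 h2 key hxq hx hc0
      rw [hc]
      clear hc c
      induction N with
      | zero => simp
      | succ N ih =>
        rw [Finset.prod_range_succ, ih, hu, hq, ← Complex.exp_nat_mul, ← Complex.exp_neg,
          ← Complex.exp_add, ← Complex.exp_add]
        congr 1; push_cast; ring
    rw [h2, h3]; ring
  rw [h1] at key
  apply mul_left_cancel₀ hc0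
  rw [key, Finset.mul_sum]
  refine Finset.sum_congr rfl fun j _ => ?_
  have : Complex.exp (π * Complex.I * τ * (j * (j - 1))) * x ^ j =
      c * kwT τ w ((j : ℤ) - N) := by
    rw [hc, kwT, hx, ← Complex.exp_nat_mul, ← Complex.exp_add, ← Complex.exp_add]
    congr 1; push_cast; ring
  linear_combination kwB q (2 * N) j * this

lemma kw_norm_q {τ : ℂ} (hτ : 0 < τ.im) : ‖Complex.exp (2 * π * Complex.I * τ)‖ < 1 := by
  rw [Complex.norm_exp]
  have : (2 * π * Complex.I * τ).re = -(2 * π * τ.im) := by simp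
  rw [this, Real.exp_lt_one_iff]
  have := Real.pi_pos
  simp; positivity

lemma kwP_tendsto {q : ℂ} (hq : ‖q‖ < 1) :
    Filter.Tendsto (kwP q) Filter.atTop (nhds (∏' k : ℕ, (1 - q ^ (k + 1)))) :=
  (ModularForm.multipliable_one_sub_pow hq).hasProd.tendsto_prod_nat

lemma kw_tprod_ne {q : ℂ} (hq : ‖q‖ < 1) : ∏' k : ℕ, (1 - q ^ (k + 1)) ≠ 0 := by
  have h := tprod_one_add_ne_zero_of_summable (f := fun n : ℕ ↦ -q ^ (n + 1)) (by
    intro i; simpa [← sub_eq_add_neg] using kw_one_sub_ne hq i) (by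
    simpa using (summable_nat_add_iff 1).mpr (summable_geometric_of_lt_one (norm_nonneg _) hq))
  simpa [← sub_eq_add_neg] using h

lemma kwT_summable {τ : ℂ} (hτ : 0 < τ.im) (w : ℂ) : Summable (kwT τ w) := by
  refine ((summable_jacobiTheta₂_term_iff (w + τ / 2) τ).mpr hτ).congr fun n => ?_
  rw [kwT, jacobiTheta₂_term]; congr 1; ring

lemma kw_mult {q : ℂ} (hq : ‖q‖ < 1) (c : ℂ) : Multipliable fun k : ℕ => 1 + c * q ^ k := by
  apply multipliable_one_add_of_summable
  simpa using (summable_geometric_of_lt_one (norm_nonneg _) hq).mul_left ‖c‖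

lemma kw_mult1 {q : ℂ} (hq : ‖q‖ < 1) (c : ℂ) : Multipliable fun k : ℕ => 1 + c * q ^ (k + 1) := by
  refine (kw_mult hq (c * q)).congr fun k => ?_
  ring

lemma kwP_bounds {q : ℂ} (hq : ‖q‖ < 1) : ∃ C : ℝ, 0 ≤ C ∧ (∀ n, ‖kwP q n‖ ≤ C) ∧
    ∀ n, ‖(kwP q n)⁻¹‖ ≤ C := by
  obtain ⟨A, hA⟩ := (kwP_tendsto hq).norm.bddAbove_range
  obtain ⟨B, hB⟩ := ((kwP_tendsto hq).inv₀ (kw_tprod_ne hq)).norm.bddAbove_range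
  refine ⟨max A B, ?_, fun n => ?_, fun n => ?_⟩
  · exact (norm_nonneg _).trans ((hA ⟨0, rfl⟩).trans (le_max_left _ _))
  · exact (hA ⟨n, rfl⟩).trans (le_max_left _ _)
  · exact (hB ⟨n, rfl⟩).trans (le_max_right _ _)

/-- Jacobi triple product -/
lemma kw_jtp {τ : ℂ} (hτ : 0 < τ.im) (w : ℂ) :
    ∑' n : ℤ, kwT τ w n =
    (∏' k : ℕ, (1 - Complex.exp (2 * π * Complex.I * τ) ^ (k + 1))) *
    ((∏' k : ℕ,
      (1 + Complex.exp (2 * π * Complex.I * w) * Complex.exp (2 * π * Complex.I * τ) ^ (k + 1))) *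
    (∏' k : ℕ,
      (1 + (Complex.exp (2 * π * Complex.I * w))⁻¹ * Complex.exp (2 * π * Complex.I * τ) ^ k))) := by
  have hq := kw_norm_q hτ
  have hfin := kw_finite τ w hq
  set q := Complex.exp (2 * π * Complex.I * τ)
  set u := Complex.exp (2 * π * Complex.I * w)
  have hL : Filter.Tendsto (fun N : ℕ => (∏ k ∈ Finset.range N, (1 + u * q ^ (k + 1))) *
      (∏ k ∈ Finset.range N, (1 + u⁻¹ * q ^ k))) Filter.atTop
      (nhds ((∏' k : ℕ, (1 + u * q ^ (k + 1))) * (∏' k : ℕ, (1 + u⁻¹ * q ^ k)))) :=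
    (kw_mult1 hq u).hasProd.tendsto_prod_nat.mul (kw_mult hq u⁻¹).hasProd.tendsto_prod_nat
  set F : ℕ → ℤ → ℂ := fun N n => if -(N : ℤ) ≤ n then
    kwT τ w n * kwB q (2 * N) (n + N).toNat else 0 with hF
  have hsum : ∀ N : ℕ, ∑ j ∈ Finset.range (2 * N + 1), kwT τ w ((j : ℤ) - N) * kwB q (2 * N) j =
      ∑' n, F N n := by
    intro N
    rw [tsum_eq_sum (s := (Finset.range (2 * N + 1)).map
      ⟨fun j : ℕ => (j : ℤ) - N, fun a b h => by simpa using h⟩)]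
    · rw [Finset.sum_map]
      refine Finset.sum_congr rfl fun j _ => ?_
      change _ = F N ((j : ℤ) - N)
      simp [hF]
    · intro n hn
      simp only [hF]
      split_ifs with h
      · have : ¬ (n + N).toNat ≤ 2 * N := by
          intro h'
          apply hn
          simp only [Finset.mem_map, Finset.mem_range]
          refine ⟨(n + N).toNat, by omega, ?_⟩
          change (((n + N).toNat : ℕ) : ℤ) - N = n
          omega
        simp [kwB, this]
      · rfl
  obtain ⟨C, hC0, hC1, hC2⟩ := kwP_bounds hq
  have hlim : Filter.Tendsto (fun N => ∑' n, F N n) Filter.atTop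
      (nhds (∑' n, kwT τ w n * (∏' k : ℕ, (1 - q ^ (k + 1)))⁻¹)) := by
    refine tendsto_tsum_of_dominated_convergence (bound := fun n => ‖kwT τ w n‖ * (C * (C * C)))
      ((kwT_summable hτ w).norm.mul_right _) ?_ ?_
    · intro n
      have hP := kwP_tendsto hq
      have hP0 := kw_tprod_ne hq
      set P := ∏' k : ℕ, (1 - q ^ (k + 1))
      have t1 : Filter.Tendsto (fun N : ℕ => 2 * N) Filter.atTop Filter.atTop :=
        Filter.tendsto_atTop_mono (fun N => by simp only [id]; omega) Filter.tendsto_id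
      have t2 : Filter.Tendsto (fun N : ℕ => (n + N).toNat) Filter.atTop Filter.atTop := by
        refine Filter.tendsto_atTop_mono (f := fun N : ℕ => N - n.natAbs) (fun N => by omega) ?_
        exact Filter.tendsto_sub_atTop_nat _
      have t3 : Filter.Tendsto (fun N : ℕ => 2 * N - (n + N).toNat) Filter.atTop Filter.atTop := by
        refine Filter.tendsto_atTop_mono (f := fun N : ℕ => N - n.natAbs) (fun N => by omega) ?_
        exact Filter.tendsto_sub_atTop_nat _
      have := (((hP.comp t1).div ((hP.comp t2).mul (hP.comp t3)) (mul_ne_zero hP0 hP0))).const_mul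
        (kwT τ w n)
      have e : P / (P * P) = P⁻¹ := by field_simp
      rw [e] at this
      refine this.congr' ?_
      filter_upwards [Filter.eventually_ge_atTop n.natAbs] with N hN
      have a1 : -(N : ℤ) ≤ n := by omega
      have a2 : (n + N).toNat ≤ 2 * N := by omega
      simp only [hF, kwB, if_pos a1, if_pos a2, Pi.div_apply, Function.comp]
    · refine Filter.Eventually.of_forall fun N n => ?_
      have hb : ‖kwB q (2 * N) (n + N).toNat‖ ≤ C * (C * C) := by
        rw [kwB]
        split_ifs
        · rw [div_eq_mul_inv, mul_inv, norm_mul, norm_mul]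
          gcongr <;> simp only [hC1, hC2]
        · simp; positivity
      simp only [hF]
      split_ifs
      · rw [norm_mul]; gcongr
      · simp; positivity
  have hfin' : ∀ N, _ = ∑' n, F N n := fun N => (hfin N).trans (hsum N)
  simp_rw [hfin'] at hL
  have := tendsto_nhds_unique hL hlim
  rw [this, tsum_mul_right]
  have hP0 := kw_tprod_ne hq
  field_simp

def KWE (l : Filter ℂ) (v f : ℂ → ℂ) (c : ℂ) : Prop :=
  (fun e => f e - (1 + c * v e)) =O[l] (fun e => v e ^ 2)

lemma KWE.tendsto {l : Filter ℂ} {v f : ℂ → ℂ} {c : ℂ} (hv : Filter.Tendsto v l (nhds 0))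
    (h : KWE l v f c) : Filter.Tendsto f l (nhds 1) := by
  have h2 : Filter.Tendsto (fun e => v e ^ 2) l (nhds 0) := by simpa using hv.pow 2
  have h3 := Asymptotics.IsBigO.trans_tendsto h h2
  have h4 : Filter.Tendsto (fun e => 1 + c * v e) l (nhds 1) := by
    simpa using (hv.const_mul c).const_add 1
  simpa using h3.add h4

lemma KWE.mul {l : Filter ℂ} {v f g : ℂ → ℂ} {c d : ℂ} (hv : Filter.Tendsto v l (nhds 0))
    (hf : KWE l v f c) (hg : KWE l v g d) : KWE l v (fun e => f e * g e) (c + d) := by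
  have h1 := (hf.tendsto hv).isBigO_one ℂ
  have h4 : Filter.Tendsto (fun e => 1 + d * v e) l (nhds 1) := by
    simpa using (hv.const_mul d).const_add 1
  have a1 := h1.mul hg
  have a2 := (h4.isBigO_one ℂ).mul hf
  have a3 : (fun e => c * d * v e ^ 2) =O[l] (fun e => v e ^ 2) :=
    (Asymptotics.isBigO_refl _ _).const_mul_left _
  simp only [one_mul] at a1 a2
  refine ((a1.add a2).add a3).congr_left fun e => ?_
  ring

lemma KWE.one (l : Filter ℂ) (v : ℂ → ℂ) : KWE l v (fun _ => 1) 0 := by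
  simpa [KWE] using Asymptotics.isBigO_zero _ _

lemma KWE.pow {l : Filter ℂ} {v f : ℂ → ℂ} {c : ℂ} (hv : Filter.Tendsto v l (nhds 0))
    (hf : KWE l v f c) (n : ℕ) : KWE l v (fun e => f e ^ n) (n * c) := by
  induction n with
  | zero => simpa using KWE.one l v
  | succ n ih =>
    have := ih.mul hv hf
    simp only [pow_succ]
    convert this using 1
    push_cast; ring

lemma KWE.inv {l : Filter ℂ} {v f : ℂ → ℂ} {c : ℂ} (hv : Filter.Tendsto v l (nhds 0))
    (hf : KWE l v f c) : KWE l v (fun e => (f e)⁻¹) (-c) := by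
  have h1 := hf.tendsto hv
  have h2 := (h1.inv₀ one_ne_zero).isBigO_one ℂ
  have h4 : Filter.Tendsto (fun e => 1 - c * v e) l (nhds 1) := by
    simpa using (hv.const_mul c).const_sub 1
  have a2 := (h4.isBigO_one ℂ).mul hf
  have a3 : (fun e => c ^ 2 * v e ^ 2) =O[l] (fun e => v e ^ 2) :=
    (Asymptotics.isBigO_refl _ _).const_mul_left _
  simp only [one_mul] at a2
  have a4 := h2.mul (a3.sub a2)
  simp only [one_mul] at a4
  refine a4.congr' ?_ Filter.EventuallyEq.rfl
  filter_upwards [h1.eventually_ne one_ne_zero] with e he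
  field_simp
  ring

lemma kw_fin_bound (a : ℕ → ℂ) (t : Finset ℕ) :
    ‖∏ i ∈ t, (1 + a i) - 1 - ∑ i ∈ t, a i‖ ≤
      Real.exp (∑ i ∈ t, ‖a i‖) - 1 - ∑ i ∈ t, ‖a i‖ := by
  classical
  induction t using Finset.induction_on with
  | empty => simp
  | insert x t hx IH =>
    rw [Finset.prod_insert hx, Finset.sum_insert hx, Finset.sum_insert hx, Real.exp_add,
      show (1 + a x) * ∏ i ∈ t, (1 + a i) - 1 - (a x + ∑ i ∈ t, a i) =
        (∏ i ∈ t, (1 + a i) - 1 - ∑ i ∈ t, a i) + a x * (∏ i ∈ t, (1 + a i) - 1) by ring]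
    have h1 := t.norm_prod_one_add_sub_one_le a
    refine (norm_add_le_of_le IH (norm_mul_le _ _)).trans ?_
    have h2 := mul_le_mul_of_nonneg_left h1 (norm_nonneg (a x))
    have h3 := mul_le_mul_of_nonneg_right (Real.add_one_le_exp ‖a x‖)
      (Real.exp_nonneg (∑ i ∈ t, ‖a i‖))
    linarith

lemma kw_prod_expand (a : ℕ → ℂ) (ha : Summable fun i => ‖a i‖) :
    (fun y : ℂ => ∏' k, (1 + y * a k) - (1 + y * ∑' k, a k)) =O[nhds 0] (fun y => y ^ 2) := by
  set A := ∑' i, ‖a i‖ with hA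
  have hA0 : 0 ≤ A := tsum_nonneg fun _ => norm_nonneg _
  refine Asymptotics.IsBigO.of_bound (A ^ 2) ?_
  have hev : ∀ᶠ y : ℂ in nhds 0, ‖y‖ * A < 1 := by
    have : Filter.Tendsto (fun y : ℂ => ‖y‖ * A) (nhds 0) (nhds (‖(0:ℂ)‖ * A)) :=
      (continuous_norm.mul continuous_const).tendsto 0
    simp only [norm_zero, zero_mul] at this
    exact this.eventually_lt_const one_pos
  filter_upwards [hev] with y hy
  have hs : Summable fun i => ‖y * a i‖ := by simpa using ha.mul_left ‖y‖
  have hm := (multipliable_one_add_of_summable hs).hasProd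
  have hsum := (hs.of_norm).hasSum
  have hl := ((hm.sub_const 1).sub hsum).norm
  have hr := ((((Real.continuous_exp.tendsto _).comp hs.hasSum).sub_const 1).sub hs.hasSum)
  have hle := le_of_tendsto_of_tendsto hl hr (Filter.Eventually.of_forall fun t =>
    kw_fin_bound (fun i => y * a i) t)
  rw [tsum_mul_left] at hle
  have e : ∑' i, ‖y * a i‖ = ‖y‖ * A := by simp [tsum_mul_left, hA]
  rw [e] at hle
  have h0 : 0 ≤ ‖y‖ * A := by positivity
  have := Real.abs_exp_sub_one_sub_id_le (x := ‖y‖ * A) (by rw [abs_of_nonneg h0]; exact hy.le)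
  rw [norm_pow, ← sub_sub]
  calc _ ≤ _ := hle
    _ ≤ _ := (le_abs_self _).trans this
    _ = _ := by ring

noncomputable def kwv (e : ℂ) : ℂ := (π * e) ^ 2

lemma kwv_tendsto : Filter.Tendsto kwv (nhdsWithin 0 {0}ᶜ) (nhds 0) := by
  have : Continuous kwv := by unfold kwv; fun_prop
  have h := this.tendsto 0
  simp only [kwv, mul_zero, ne_eq, OfNat.ofNat_ne_zero, not_false_eq_true, zero_pow] at h
  exact h.mono_left nhdsWithin_le_nhds

lemma kw_small : ∀ᶠ e : ℂ in nhdsWithin 0 {0}ᶜ, ‖(π : ℂ) * e‖ ≤ 1 ∧ (π : ℂ) * e ≠ 0 := by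
  have : Filter.Tendsto (fun e : ℂ => ‖(π : ℂ) * e‖) (nhdsWithin 0 {0}ᶜ) (nhds 0) := by
    have : Continuous fun e : ℂ => ‖(π : ℂ) * e‖ := by fun_prop
    have h := this.tendsto 0
    simp only [mul_zero, norm_zero] at h
    exact h.mono_left nhdsWithin_le_nhds
  filter_upwards [this.eventually_lt_const one_pos, self_mem_nhdsWithin] with e h1 h2
  exact ⟨h1.le, mul_ne_zero (by exact_mod_cast Real.pi_ne_zero) h2⟩

lemma kw_cos : KWE (nhdsWithin 0 {0}ᶜ) kwv (fun e => Complex.cos (π * e)) (-1 / 2) := by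
  refine Asymptotics.IsBigO.of_bound (5 / 96) ?_
  filter_upwards [kw_small] with e he
  have := Complex.cos_bound he.1
  rw [kwv, norm_pow, norm_pow]
  convert this using 1
  · congr 1; ring
  · ring

lemma kw_sinc : KWE (nhdsWithin 0 {0}ᶜ) kwv (fun e => Complex.sin (π * e) / (π * e)) (-1 / 6) := by
  refine Asymptotics.IsBigO.of_bound (1 / 100) ?_
  filter_upwards [kw_small] with e he
  have := Complex.sin_bound he.1
  rw [kwv, norm_pow, norm_pow]
  generalize (π : ℂ) * e = u at *
  have h0 : 0 < ‖u‖ := norm_pos_iff.mpr he.2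
  have e1 : Complex.sin u / u - (1 + -1 / 6 * u ^ 2) = (Complex.sin u - (u - u ^ 3 / 6)) / u := by
    have := he.2
    field_simp
    ring
  rw [e1, norm_div, div_le_iff₀ h0]
  calc _ ≤ _ := this
    _ = _ := by ring

lemma kw_sin_sq : (fun e => Complex.sin (π * e) ^ 2 - kwv e) =O[nhdsWithin 0 {0}ᶜ]
    (fun e => kwv e ^ 2) := by
  have h := kw_sinc.pow kwv_tendsto 2
  have h2 : (fun e => ((2 : ℕ) : ℂ) * (-1 / 6) * kwv e) =O[nhdsWithin 0 {0}ᶜ] kwv :=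
    (Asymptotics.isBigO_refl _ _).const_mul_left _
  have h1 : (fun e => kwv e ^ 2) =O[nhdsWithin 0 {0}ᶜ] kwv := by
    simpa [pow_two] using (kwv_tendsto.isBigO_one ℂ).mul (Asymptotics.isBigO_refl kwv _)
  have h3 := (Asymptotics.isBigO_refl kwv (nhdsWithin 0 {0}ᶜ)).mul ((h.trans h1).add h2)
  refine h3.congr' ?_ (Filter.Eventually.of_forall fun e => by simp [pow_two])
  filter_upwards [kw_small] with e he
  have := he.2
  simp only [kwv]
  generalize (π : ℂ) * e = u at *
  field_simp
  ring

lemma kw_H (a : ℕ → ℂ) (ha : Summable fun i => ‖a i‖) :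
    KWE (nhdsWithin 0 {0}ᶜ) kwv (fun e => ∏' k, (1 + Complex.sin (π * e) ^ 2 * a k))
      (∑' k, a k) := by
  have h1 : (fun e => kwv e ^ 2) =O[nhdsWithin 0 {0}ᶜ] kwv := by
    simpa [pow_two] using (kwv_tendsto.isBigO_one ℂ).mul (Asymptotics.isBigO_refl kwv _)
  have hO : (fun e => Complex.sin (π * e) ^ 2) =O[nhdsWithin 0 {0}ᶜ] kwv := by
    simpa using (kw_sin_sq.trans h1).add (Asymptotics.isBigO_refl kwv _)
  have ht := hO.trans_tendsto kwv_tendsto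
  have h2 := ((kw_prod_expand a ha).comp_tendsto ht).trans (hO.pow 2)
  have h3 := kw_sin_sq.const_mul_left (∑' k, a k)
  refine (h2.add h3).congr_left fun e => ?_
  simp only [Function.comp]
  ring

noncomputable def kwa (q s : ℂ) (k : ℕ) : ℂ := 4 * (s * q ^ (k + 1)) / (1 - s * q ^ (k + 1)) ^ 2

lemma kw_lower {q s : ℂ} (hq : ‖q‖ < 1) (hs : ‖s‖ = 1) (k : ℕ) :
    1 - ‖q‖ ≤ ‖1 - s * q ^ (k + 1)‖ := by
  have h := norm_sub_norm_le (1 : ℂ) (s * q ^ (k + 1))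
  rw [norm_one, norm_mul, hs, one_mul, norm_pow] at h
  have : ‖q‖ ^ (k + 1) ≤ ‖q‖ := pow_le_of_le_one (norm_nonneg _) hq.le (by simp)
  linarith

lemma kw_ne {q s : ℂ} (hq : ‖q‖ < 1) (hs : ‖s‖ = 1) (k : ℕ) : 1 - s * q ^ (k + 1) ≠ 0 := by
  have := kw_lower hq hs k
  rw [← norm_pos_iff]; linarith

lemma kwa_summable {q s : ℂ} (hq : ‖q‖ < 1) (hs : ‖s‖ = 1) : Summable fun k => ‖kwa q s k‖ := by
  have hg : Summable fun k : ℕ => 4 / (1 - ‖q‖) ^ 2 * ‖q‖ ^ (k + 1) :=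
    ((summable_nat_add_iff 1).mpr (summable_geometric_of_lt_one (norm_nonneg _) hq)).mul_left _
  refine hg.of_nonneg_of_le (fun _ => norm_nonneg _) fun k => ?_
  have h1 := kw_lower hq hs k
  have h2 : 0 < 1 - ‖q‖ := by linarith
  rw [kwa, norm_div, norm_mul, norm_mul, hs, norm_pow, norm_pow, one_mul, div_mul_eq_mul_div]
  norm_num
  gcongr

lemma kw_prod_split {q s : ℂ} (hq : ‖q‖ < 1) (hs : ‖s‖ = 1) (hs2 : s ^ 2 = 1) (y u : ℂ)
    (hu : u ≠ 0) (huy : u + u⁻¹ = -2 * s + 4 * s * y) :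
    (∏' k : ℕ, (1 + u * q ^ (k + 1))) * (∏' k : ℕ, (1 + u⁻¹ * q ^ (k + 1))) =
      (∏' k : ℕ, (1 - s * q ^ (k + 1))) ^ 2 * ∏' k, (1 + y * kwa q s k) := by
  have m1 := kw_mult1 hq u
  have m2 := kw_mult1 hq u⁻¹
  have m3 : Multipliable fun k : ℕ => 1 - s * q ^ (k + 1) :=
    (kw_mult1 hq (-s)).congr fun k => by ring
  have m4 : Multipliable fun k : ℕ => 1 + y * kwa q s k :=
    multipliable_one_add_of_summable (by simpa using (kwa_summable hq hs).mul_left ‖y‖)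
  rw [← m1.tprod_mul m2, pow_two, ← m3.tprod_mul m3, ← (m3.mul m3).tprod_mul m4]
  refine tprod_congr fun k => ?_
  have := kw_ne hq hs k
  rw [kwa]
  generalize q ^ (k + 1) = Q at *
  have huu : u * u⁻¹ = 1 := mul_inv_cancel₀ hu
  generalize u⁻¹ = w at *
  have hD : (1 - s * Q) * (1 - s * Q) * (1 + y * (4 * (s * Q) / (1 - s * Q) ^ 2)) =
      (1 - s * Q) ^ 2 + 4 * y * (s * Q) := by
    generalize 1 - s * Q = D at *
    field_simp
  rw [hD]
  linear_combination Q * huy + Q ^ 2 * huu - Q ^ 2 * hs2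

lemma kw_theta {τ : ℂ} (hτ : 0 < τ.im) (z s y : ℂ) (hs : ‖s‖ = 1) (hs2 : s ^ 2 = 1)
    (hy : Complex.cos (2 * π * (z + 1 / 2)) = - s + 2 * s * y) :
    jacobiThetaKW z τ = 2 * Complex.cos (π * (z + 1 / 2)) * (Complex.exp (π * Complex.I * τ / 4) *
      (∏' k : ℕ, (1 - Complex.exp (2 * π * Complex.I * τ) ^ (k + 1))) *
      (∏' k : ℕ, (1 - s * Complex.exp (2 * π * Complex.I * τ) ^ (k + 1))) ^ 2) *
      ∏' k, (1 + y * kwa (Complex.exp (2 * π * Complex.I * τ)) s k) := by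
  have hq := kw_norm_q hτ
  have h1 : jacobiThetaKW z τ = Complex.exp (π * Complex.I * τ / 4) *
      Complex.exp (π * Complex.I * (z + 1 / 2)) * ∑' n : ℤ, kwT τ (z + 1 / 2) n := by
    rw [jacobiThetaKW, ← tsum_mul_left]
    refine tsum_congr fun n => ?_
    rw [kwT, ← Complex.exp_add, ← Complex.exp_add]
    congr 1; ring
  rw [h1, kw_jtp hτ]
  set q := Complex.exp (2 * π * Complex.I * τ)
  set u := Complex.exp (2 * π * Complex.I * (z + 1 / 2)) with hu
  have hu0 : u ≠ 0 := Complex.exp_ne_zero _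
  have huy : u + u⁻¹ = -2 * s + 4 * s * y := by
    have : Complex.cos (2 * π * (z + 1 / 2)) = (u + u⁻¹) / 2 := by
      rw [Complex.cos, hu, ← Complex.exp_neg]
      congr 3 <;> ring
    linear_combination 2 * hy - 2 * this
  have hz : ∏' k : ℕ, (1 + u⁻¹ * q ^ k) = (1 + u⁻¹) * ∏' k : ℕ, (1 + u⁻¹ * q ^ (k + 1)) := by
    rw [tprod_eq_zero_mul' (f := fun k : ℕ => 1 + u⁻¹ * q ^ k) (kw_mult1 hq u⁻¹)]
    simp
  have hc : Complex.exp (π * Complex.I * (z + 1 / 2)) * (1 + u⁻¹) =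
      2 * Complex.cos (π * (z + 1 / 2)) := by
    rw [Complex.cos, hu, ← Complex.exp_neg, mul_add, ← Complex.exp_add, mul_one,
      mul_div_cancel₀ _ two_ne_zero]
    congr 2 <;> ring
  have hsp := kw_prod_split hq hs hs2 y u hu0 huy
  rw [hz]
  generalize (∏' k : ℕ, (1 - q ^ (k + 1))) = P at *
  generalize (∏' k : ℕ, (1 + u * q ^ (k + 1))) = U1 at *
  generalize (∏' k : ℕ, (1 + u⁻¹ * q ^ (k + 1))) = U2 at *
  rw [← hc]
  linear_combination Complex.exp (π * Complex.I * τ / 4) *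
      Complex.exp (π * Complex.I * (z + 1 / 2)) * P * (1 + u⁻¹) * hsp

lemma kw_theta_zero {τ : ℂ} (hτ : 0 < τ.im) (e : ℂ) :
    jacobiThetaKW e τ = -2 * Complex.sin (π * e) * (Complex.exp (π * Complex.I * τ / 4) *
      (∏' k : ℕ, (1 - Complex.exp (2 * π * Complex.I * τ) ^ (k + 1))) ^ 3) *
      ∏' k, (1 + Complex.sin (π * e) ^ 2 * kwa (Complex.exp (2 * π * Complex.I * τ)) 1 k) := by
  rw [kw_theta hτ e 1 (Complex.sin (π * e) ^ 2) (by simp) (by simp)]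
  · have : Complex.cos (π * (e + 1 / 2)) = - Complex.sin (π * e) := by
      rw [← Complex.cos_add_pi_div_two]; congr 1; ring
    rw [this]
    simp only [one_mul]
    ring
  · have : 2 * π * (e + 1 / 2) = 2 * (π * e) + π := by ring
    rw [this, Complex.cos_add_pi, Complex.cos_two_mul, Complex.cos_sq']
    ring

lemma kw_theta_half {τ : ℂ} (hτ : 0 < τ.im) (e : ℂ) :
    jacobiThetaKW (e + 1 / 2) τ = -2 * Complex.cos (π * e) * (Complex.exp (π * Complex.I * τ / 4) *
      (∏' k : ℕ, (1 - Complex.exp (2 * π * Complex.I * τ) ^ (k + 1))) *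
      (∏' k : ℕ, (1 + Complex.exp (2 * π * Complex.I * τ) ^ (k + 1))) ^ 2) *
      ∏' k, (1 + Complex.sin (π * e) ^ 2 * kwa (Complex.exp (2 * π * Complex.I * τ)) (-1) k) := by
  rw [kw_theta hτ (e + 1 / 2) (-1) (Complex.sin (π * e) ^ 2) (by simp) (by simp)]
  · have : Complex.cos (π * (e + 1 / 2 + 1 / 2)) = - Complex.cos (π * e) := by
      rw [← Complex.cos_add_pi]; congr 1; ring
    rw [this]
    simp only [neg_mul, one_mul, sub_neg_eq_add]
    ring
  · have : 2 * π * (e + 1 / 2 + 1 / 2) = 2 * (π * e) + 2 * π := by ring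
    rw [this, Complex.cos_add_two_pi, Complex.cos_two_mul, Complex.cos_sq']
    ring

lemma kw_P2 {q : ℂ} (hq : ‖q‖ < 1) : ∏' k : ℕ, (1 - (q ^ 2) ^ (k + 1)) =
    (∏' k : ℕ, (1 - q ^ (k + 1))) * ∏' k : ℕ, (1 + q ^ (k + 1)) := by
  rw [← (ModularForm.multipliable_one_sub_pow hq).tprod_mul (by simpa using kw_mult1 hq 1)]
  refine tprod_congr fun k => ?_
  ring

lemma kw_eta (τ : ℂ) : dedekindEta τ = Complex.exp (π * Complex.I * τ / 12) *
    ∏' k : ℕ, (1 - Complex.exp (2 * π * Complex.I * τ) ^ (k + 1)) := by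
  rw [dedekindEta]
  congr 1
  refine tprod_congr fun k => ?_
  rw [← Complex.exp_nat_mul]
  congr 2; push_cast; ring

lemma kw_q2 (τ : ℂ) : Complex.exp (2 * π * Complex.I * (2 * τ)) =
    Complex.exp (2 * π * Complex.I * τ) ^ 2 := by
  rw [← Complex.exp_nat_mul]; congr 1; push_cast; ring

lemma kw_E2 {τ : ℂ} (hτ : 0 < τ.im) : eisensteinE2 τ = 1 - 6 *
    ∑' k, kwa (Complex.exp (2 * π * Complex.I * τ)) 1 k := by
  have hq := kw_norm_q hτ
  rw [eisensteinE2]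
  have e1 : ∀ k : ℕ, Complex.exp (2 * π * Complex.I * τ * ((k : ℂ) + 1)) =
      Complex.exp (2 * π * Complex.I * τ) ^ (k + 1) := by
    intro k; rw [← Complex.exp_nat_mul]; congr 1; push_cast; ring
  simp_rw [e1]
  set q := Complex.exp (2 * π * Complex.I * τ)
  have h := tsum_prod_pow_eq_tsum_sigma 1 hq
  rw [tsum_pnat_eq_tsum_succ (f := fun n => ((ArithmeticFunction.sigma 1 n : ℕ) : ℂ) * q ^ n)] at h
  rw [← h]
  have h2 : ∀ d : ℕ+, ∑' c : ℕ+, (c : ℂ) ^ 1 * q ^ (d * c : ℕ) =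
      q ^ (d : ℕ) / (1 - q ^ (d : ℕ)) ^ 2 := by
    intro d
    have hd : ‖q ^ (d : ℕ)‖ < 1 := by
      rw [norm_pow]; exact pow_lt_one₀ (norm_nonneg _) hq d.ne_zero
    rw [← tsum_coe_mul_geometric_of_norm_lt_one hd]
    rw [← tsum_zero_pnat_eq_tsum_nat (f := fun n : ℕ => (n : ℂ) * (q ^ (d : ℕ)) ^ n)
      (hasSum_coe_mul_geometric_of_norm_lt_one hd).summable]
    simp [pow_mul]
  rw [tsum_congr h2, tsum_pnat_eq_tsum_succ (f := fun n => q ^ n / (1 - q ^ n) ^ 2)]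
  have h3 : ∀ k, kwa q 1 k = 4 * (q ^ (k + 1) / (1 - q ^ (k + 1)) ^ 2) := by
    intro k; rw [kwa]; simp only [one_mul]; ring
  simp_rw [h3, tsum_mul_left]
  ring

lemma kw_S {q : ℂ} (hq : ‖q‖ < 1) : ∑' k, kwa q (-1) k =
    4 * ∑' k, kwa (q ^ 2) 1 k - ∑' k, kwa q 1 k := by
  have hq2 : ‖q ^ 2‖ < 1 := by
    rw [norm_pow]; exact pow_lt_one₀ (norm_nonneg _) hq (by simp)
  have s1 := (kwa_summable hq (s := 1) (by simp)).of_norm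
  have s2 := (kwa_summable hq2 (s := 1) (by simp)).of_norm
  rw [← tsum_mul_left, ← (s2.mul_left 4).tsum_sub s1]
  refine tsum_congr fun k => ?_
  have n1 := kw_ne hq (s := 1) (by simp) k
  have n2 := kw_ne hq (s := -1) (by simp) k
  have e : (q ^ 2) ^ (k + 1) = (q ^ (k + 1)) ^ 2 := by ring
  simp only [kwa, e]
  generalize q ^ (k + 1) = Q at *
  have e2 : 1 - 1 * Q ^ 2 = (1 - 1 * Q) * (1 - -1 * Q) := by ring
  rw [e2]
  have hQ : Q = 1 - (1 - 1 * Q) := by ring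
  have e3 : 1 - -1 * Q = 2 - (1 - 1 * Q) := by ring
  rw [e3] at n2 ⊢
  generalize 1 - 1 * Q = D at *
  subst hQ
  field_simp
  ring

/-- Let `m ≥ 6` be an even integer and `τ ∈ ℍ`. With
`D̃₄(τ) := 2^m η(2τ)^{2m}/η(τ)^{m+12}` and
`D̃₂(τ) := 2^m η(2τ)^{2m}/η(τ)^{m+12} · ((−m/24 − 1/6) E₂(τ) + (m/6) E₂(2τ))`,
the function `ε ↦ ϑ(ε + 1/2; τ)^m/ϑ(ε; τ)^4 − D̃₄(τ)/(2πiε)^4 − D̃₂(τ)/(2πiε)²` is bounded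
in a punctured neighborhood of `ε = 0`. -/
theorem stmt_14 (m : ℕ) (hm : 6 ≤ m) (hme : Even m) (τ : ℂ) (hτ : 0 < τ.im) :
    ∃ C : ℝ, ∀ᶠ ε : ℂ in nhdsWithin 0 {0}ᶜ,
      ‖jacobiThetaKW (ε + 1 / 2) τ ^ m / jacobiThetaKW ε τ ^ 4 -
          (2 ^ m * dedekindEta (2 * τ) ^ (2 * m) / dedekindEta τ ^ (m + 12)) /
            (2 * π * Complex.I * ε) ^ 4 -
          (2 ^ m * dedekindEta (2 * τ) ^ (2 * m) / dedekindEta τ ^ (m + 12) *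
              ((-(m : ℂ) / 24 - 1 / 6) * eisensteinE2 τ + ((m : ℂ) / 6) * eisensteinE2 (2 * τ))) /
            (2 * π * Complex.I * ε) ^ 2‖ ≤ C := by
  have hq := kw_norm_q hτ
  have hv := kwv_tendsto
  have hE1 := kw_E2 hτ
  have hE2 := kw_E2 (τ := 2 * τ) (by simpa using hτ)
  have hη1 := kw_eta τ
  have hη2 := kw_eta (2 * τ)
  rw [kw_q2] at hE2 hη2
  rw [kw_P2 hq] at hη2
  have hS := kw_S hq
  have hth0 := kw_theta_zero hτ
  have hth1 := kw_theta_half hτ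
  have hP0 := kw_tprod_ne hq
  have hH1 := kw_H _ (kwa_summable hq (s := 1) (by simp))
  have hH2 := kw_H _ (kwa_summable hq (s := -1) (by simp))
  set q := Complex.exp (2 * π * Complex.I * τ)
  set Sp := ∑' k, kwa q 1 k
  set Sm := ∑' k, kwa q (-1) k
  set S2 := ∑' k, kwa (q ^ 2) 1 k
  set P := ∏' k : ℕ, (1 - q ^ (k + 1))
  set R := ∏' k : ℕ, (1 + q ^ (k + 1))
  set Y := Complex.exp (π * Complex.I * τ / 12) with hY
  have hY0 : Y ≠ 0 := Complex.exp_ne_zero _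
  have hX : Complex.exp (π * Complex.I * τ / 4) = Y ^ 3 := by
    rw [hY, ← Complex.exp_nat_mul]; congr 1; push_cast; ring
  have hY2 : Complex.exp (π * Complex.I * (2 * τ) / 12) = Y ^ 2 := by
    rw [hY, ← Complex.exp_nat_mul]; congr 1; push_cast; ring
  rw [hX] at hth0 hth1
  rw [hY2] at hη2
  set D := (2 ^ m * dedekindEta (2 * τ) ^ (2 * m) / dedekindEta τ ^ (m + 12)) with hD
  have hDK : D = (2 * (Y ^ 3 * P * R ^ 2)) ^ m / (Y ^ 3 * P ^ 3) ^ 4 := by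
    rw [hD, hη1, hη2]
    have : (Y ^ 2 * (P * R)) ^ (2 * m) = Y ^ (4 * m) * P ^ (2 * m) * R ^ (2 * m) := by
      rw [mul_pow, mul_pow, ← pow_mul]; ring
    rw [div_eq_div_iff (by positivity) (by positivity), this]
    simp only [mul_pow, ← pow_mul, pow_add]
    ring
  have hQ := ((kw_cos.pow hv m).mul hv (hH2.pow hv m)).mul hv
    (((kw_sinc.inv hv).pow hv 4).mul hv ((hH1.inv hv).pow hv 4))
  set c : ℂ := (m : ℂ) * (-1 / 2) + m * Sm + (((4 : ℕ) : ℂ) * -(-1 / 6) + ((4 : ℕ) : ℂ) * -Sp)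
    with hc
  rw [KWE] at hQ
  obtain ⟨C, hC⟩ := hQ.bound
  refine ⟨‖D / 16‖ * C, ?_⟩
  filter_upwards [hC, kw_small] with e he hsm
  have hv0 : kwv e ≠ 0 := pow_ne_zero _ hsm.2
  have hx2 : (2 * π * Complex.I * e) ^ 2 = -4 * kwv e := by
    rw [kwv]; linear_combination 4 * (π : ℂ) ^ 2 * e ^ 2 * Complex.I_sq
  have hx4 : (2 * π * Complex.I * e) ^ 4 = 16 * kwv e ^ 2 := by
    rw [show (2 * π * Complex.I * e) ^ 4 = ((2 * π * Complex.I * e) ^ 2) ^ 2 by ring, hx2]; ring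
  have hcoef : (-(m : ℂ) / 24 - 1 / 6) * eisensteinE2 τ + ((m : ℂ) / 6) * eisensteinE2 (2 * τ) =
      -c / 4 := by
    rw [hE1, hE2, hc, hS]; push_cast; ring
  rw [hcoef, hx2, hx4]
  have hratio : jacobiThetaKW (e + 1 / 2) τ ^ m / jacobiThetaKW e τ ^ 4 =
      D / 16 * (Complex.cos (π * e) ^ m * (∏' k, (1 + Complex.sin (π * e) ^ 2 * kwa q (-1) k)) ^ m *
        ((Complex.sin (π * e) / (π * e))⁻¹ ^ 4 *
          (∏' k, (1 + Complex.sin (π * e) ^ 2 * kwa q 1 k))⁻¹ ^ 4)) / kwv e ^ 2 := by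
    rw [hth1 e, hth0 e, hDK]
    generalize (∏' k, (1 + Complex.sin (π * e) ^ 2 * kwa q (-1) k)) = H2
    generalize (∏' k, (1 + Complex.sin (π * e) ^ 2 * kwa q 1 k)) = H1
    have e1 : (-2 * Complex.cos (π * e) * (Y ^ 3 * P * R ^ 2) * H2) ^ m =
        (2 * (Y ^ 3 * P * R ^ 2)) ^ m * (Complex.cos (π * e) ^ m * H2 ^ m) := by
      rw [← mul_pow, ← mul_pow, ← hme.neg_pow]; congr 1; ring
    rw [e1]
    have e2 : (-2 * Complex.sin (π * e) * (Y ^ 3 * P ^ 3) * H1) ^ 4 =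
        16 * (Y ^ 3 * P ^ 3) ^ 4 * (Complex.sin (π * e) ^ 4 * H1 ^ 4) := by ring
    rw [e2, kwv, inv_div]
    generalize (2 * (Y ^ 3 * P * R ^ 2)) ^ m = A
    generalize Complex.cos (π * e) ^ m * H2 ^ m = B
    have hu := hsm.2
    generalize (π : ℂ) * e = u at *
    rw [div_pow, inv_pow, div_mul_eq_mul_div, div_mul_eq_mul_div]
    simp only [div_eq_mul_inv, mul_inv]
    have : u ^ 4 * ((u ^ 2) ^ 2)⁻¹ = 1 := by field_simp
    linear_combination (-(A * B * 16⁻¹ * ((Y ^ 3 * P ^ 3) ^ 4)⁻¹ * (Complex.sin u ^ 4)⁻¹ *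
      (H1 ^ 4)⁻¹)) * this
  rw [hratio]
  generalize (Complex.cos (π * e) ^ m * (∏' k, (1 + Complex.sin (π * e) ^ 2 * kwa q (-1) k)) ^ m *
        ((Complex.sin (π * e) / (π * e))⁻¹ ^ 4 *
          (∏' k, (1 + Complex.sin (π * e) ^ 2 * kwa q 1 k))⁻¹ ^ 4)) = Q at *
  have hfin : D / 16 * Q / kwv e ^ 2 - D / (16 * kwv e ^ 2) - D * (-c / 4) / (-4 * kwv e) =
      D / 16 * ((Q - (1 + c * kwv e)) / kwv e ^ 2) := by
    field_simp
    ring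
  rw [hfin, norm_mul]
  gcongr
  rw [norm_div, div_le_iff₀ (norm_pos_iff.mpr (pow_ne_zero _ hv0))]
  exact he
end

section
/- There exist constants C > 0 and t₀ > 0 such that for all 0 < t < t₀ and all u ∈ [−1/2, 1/2]: (i) |ϑ(u/(it) + 1/2 + 1/(2it); i/t) + e^{πu/t + π/(4t)}| ≤ C e^{πu/t + π/(4t)} e^{(2π|u| − π)/t}, and (ii) |ϑ(u/(it) + 1/2; i/t) + 2 e^{−π/(4t)} cosh(πu/t)| ≤ C e^{−π/(4t)} cosh(πu/t) e^{(2π|u| − π)/t}. In particular, ϑ(u/(it)+1/2+1/(2it); i/t) = −e^{πu/t+π/(4t)}(1 + O(e^{(2π|u|−π)/t})) and ϑ(u/(it)+1/2; i/t) = −2e^{−π/(4t)} cosh(πu/t)(1 + O(e^{(2π|u|−π)/t})) uniformly for u ∈ [−1/2,1/2] as t → 0⁺. -/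
open Real

noncomputable def rKW (n : ℤ) : ℝ := Real.exp (1 - |(n : ℝ)|)

lemma rKW_summable : Summable rKW := by
  have h : Summable (fun n : ℕ => Real.exp 1 * Real.exp (-(n : ℝ))) :=
    Real.summable_exp_neg_nat.mul_left _
  apply Summable.of_nat_of_neg
  · refine h.congr fun n => ?_
    simp [rKW, ← Real.exp_add, sub_eq_add_neg]
  · refine h.congr fun n => ?_
    simp [rKW, ← Real.exp_add, sub_eq_add_neg]

lemma rKW_tail (f : ℤ → ℂ) (s : Finset ℤ) (A : ℝ) (h : ∀ n, n ∉ s → ‖f n‖ ≤ A * rKW n)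
    (hA : 0 ≤ A) : ‖∑' n, f n - ∑ n ∈ s, f n‖ ≤ A * ∑' n, rKW n := by
  classical
  have hb : ∀ n, ‖(if n ∈ s then 0 else f n)‖ ≤ A * rKW n := by
    intro n
    split_ifs with hn
    · rw [norm_zero]; exact mul_nonneg hA (Real.exp_pos _).le
    · exact h n hn
  have hs := rKW_summable.mul_left A
  have hg : Summable (fun n => if n ∈ s then 0 else f n) := Summable.of_norm_bounded hs hb
  have h2 : HasSum (fun n => if n ∈ s then f n else 0) (∑ n ∈ s, f n) := by
    have := hasSum_sum_of_ne_finset_zero (f := fun n => if n ∈ s then f n else 0) (s := s)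
      (L := SummationFilter.unconditional ℤ)
      (by intro b hb; simp [hb])
    convert this using 1
    exact Finset.sum_congr rfl (by intro x hx; simp [hx])
  have h3 : HasSum f (∑' n, (if n ∈ s then 0 else f n) + ∑ n ∈ s, f n) := by
    convert hg.hasSum.add h2 using 1
    funext n
    split_ifs <;> simp
  rw [h3.tsum_eq, add_sub_cancel_right, ← tsum_mul_left]
  exact tsum_of_norm_bounded hs.hasSum hb

lemma exp_odd_KW (a : ℝ) (n : ℤ) (w : ℂ) (hw : w = a + (π * Complex.I + n * (2 * π * Complex.I))) :
    Complex.exp w = -((Real.exp a : ℝ) : ℂ) := by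
  rw [hw, Complex.exp_add, Complex.exp_add, Complex.exp_int_mul_two_pi_mul_I, Complex.exp_pi_mul_I]
  push_cast
  ring

lemma termKW1 (t u : ℝ) (ht : 0 < t) (n : ℤ) :
    Complex.exp (π * Complex.I * ((n : ℂ) + 1 / 2) ^ 2 * (Complex.I / t) +
      2 * π * Complex.I * ((n : ℂ) + 1 / 2) *
        (((u : ℂ) / (Complex.I * t) + 1 / 2 + 1 / (2 * Complex.I * t)) + 1 / 2))
    = -((Real.exp (π / t * (u + 1 / 4 + 2 * n * u - n ^ 2)) : ℝ) : ℂ) := by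
  apply exp_odd_KW _ n
  have ht' : (t : ℂ) ≠ 0 := by exact_mod_cast ht.ne'
  have e1 : (u : ℂ) / (Complex.I * t) = -Complex.I * u / t := by
    field_simp; rw [Complex.I_sq]; ring
  have e2 : (1 : ℂ) / (2 * Complex.I * t) = -Complex.I / (2 * t) := by
    field_simp; rw [Complex.I_sq]; ring
  rw [e1, e2]
  push_cast
  field_simp
  ring_nf
  simp only [Complex.I_sq]
  ring

lemma termKW2 (t u : ℝ) (ht : 0 < t) (n : ℤ) :
    Complex.exp (π * Complex.I * ((n : ℂ) + 1 / 2) ^ 2 * (Complex.I / t) +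
      2 * π * Complex.I * ((n : ℂ) + 1 / 2) *
        (((u : ℂ) / (Complex.I * t) + 1 / 2) + 1 / 2))
    = -((Real.exp (π / t * (-1 / 4 + (2 * n + 1) * u - n ^ 2 - n)) : ℝ) : ℂ) := by
  apply exp_odd_KW _ n
  have ht' : (t : ℂ) ≠ 0 := by exact_mod_cast ht.ne'
  have e1 : (u : ℂ) / (Complex.I * t) = -Complex.I * u / t := by
    field_simp; rw [Complex.I_sq]; ring
  rw [e1]
  push_cast
  field_simp
  ring_nf
  simp only [Complex.I_sq]
  ring

lemma scaleKW (t : ℝ) (ht : 0 < t) (ht1 : t < 1) (a b c : ℝ) (hc : c ≤ 0) (h : a ≤ b + c) :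
    Real.exp (π / t * a) ≤ Real.exp (π / t * b) * Real.exp c := by
  rw [← Real.exp_add, Real.exp_le_exp]
  have h1 : 1 ≤ π / t := by
    rw [le_div_iff₀ ht]; linarith [Real.pi_gt_three]
  nlinarith

lemma ineqKW1 (u : ℝ) (hu : u ∈ Set.Icc (-(1 / 2) : ℝ) (1 / 2)) (n : ℤ) (hn : n ≠ 0) :
    1 - |(n : ℝ)| ≤ 0 ∧
    u + 1 / 4 + 2 * n * u - n ^ 2 ≤ (u + 1 / 4 + (2 * |u| - 1)) + (1 - |(n : ℝ)|) := by
  have h1 : (1 : ℝ) ≤ |(n : ℝ)| := by exact_mod_cast Int.one_le_abs hn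
  have h2 : |u| ≤ 1 / 2 := abs_le.2 ⟨by linarith [hu.1], hu.2⟩
  have h3 : (n : ℝ) * u ≤ |(n : ℝ)| * |u| := by rw [← abs_mul]; exact le_abs_self _
  have h4 : (n : ℝ) ^ 2 = |(n : ℝ)| ^ 2 := (sq_abs _).symm
  refine ⟨by linarith, ?_⟩
  rw [h4]
  nlinarith [mul_nonneg (sub_nonneg.2 h1) (sub_nonneg.2 h2)]

lemma ineqKW2 (u : ℝ) (hu : u ∈ Set.Icc (-(1 / 2) : ℝ) (1 / 2)) (n : ℤ) (hn : n ≠ 0)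
    (hn' : n ≠ -1) :
    1 - |(n : ℝ)| ≤ 0 ∧
    -1 / 4 + (2 * n + 1) * u - n ^ 2 - n ≤ (-1 / 4 + |u| + (2 * |u| - 1)) + (1 - |(n : ℝ)|) := by
  have h1 : (1 : ℝ) ≤ |(n : ℝ)| := by exact_mod_cast Int.one_le_abs hn
  have h2 : |u| ≤ 1 / 2 := abs_le.2 ⟨by linarith [hu.1], hu.2⟩
  have h5 := le_abs_self u
  have h6 := neg_abs_le u
  refine ⟨by linarith, ?_⟩
  rcases lt_or_gt_of_ne hn with h | h
  · have h7 : (n : ℝ) ≤ -2 := by exact_mod_cast (by omega : n ≤ -2)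
    rw [abs_of_neg (by linarith : (n : ℝ) < 0)]
    nlinarith [mul_nonneg (by linarith : 0 ≤ -2 - (n : ℝ)) (sub_nonneg.2 h2),
      mul_nonneg (by linarith : 0 ≤ -2 - (n : ℝ)) (by linarith : 0 ≤ u + |u|)]
  · have h7 : (1 : ℝ) ≤ n := by exact_mod_cast h
    rw [abs_of_pos (by linarith : 0 < (n : ℝ))]
    nlinarith [mul_nonneg (by linarith : 0 ≤ (n : ℝ) - 1) (sub_nonneg.2 h2),
      mul_nonneg (by linarith : 0 ≤ (n : ℝ) - 1) (by linarith : 0 ≤ |u| - u)]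

/-- There exist constants `C > 0` and `t₀ > 0` such that for all `0 < t < t₀` and all
`u ∈ [−1/2, 1/2]`:
(i) `|ϑ(u/(it) + 1/2 + 1/(2it); i/t) + e^{πu/t + π/(4t)}| ≤ C e^{πu/t + π/(4t)} e^{(2π|u| − π)/t}`,
(ii) `|ϑ(u/(it) + 1/2; i/t) + 2 e^{−π/(4t)} cosh(πu/t)| ≤ C e^{−π/(4t)} cosh(πu/t) e^{(2π|u| − π)/t}`. -/
theorem stmt_15 :
    ∃ C : ℝ, 0 < C ∧ ∃ t₀ : ℝ, 0 < t₀ ∧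
      ∀ t : ℝ, 0 < t → t < t₀ → ∀ u : ℝ, u ∈ Set.Icc (-(1 / 2) : ℝ) (1 / 2) →
        ‖jacobiThetaKW ((u : ℂ) / (Complex.I * t) + 1 / 2 + 1 / (2 * Complex.I * t))
              (Complex.I / t) + Real.exp (π * u / t + π / (4 * t))‖
            ≤ C * Real.exp (π * u / t + π / (4 * t)) * Real.exp ((2 * π * |u| - π) / t) ∧
        ‖jacobiThetaKW ((u : ℂ) / (Complex.I * t) + 1 / 2) (Complex.I / t) +
              2 * Real.exp (-π / (4 * t)) * Real.cosh (π * u / t)‖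
            ≤ C * Real.exp (-π / (4 * t)) * Real.cosh (π * u / t) *
                Real.exp ((2 * π * |u| - π) / t) := by
  have hS : 0 < ∑' n, rKW n :=
    rKW_summable.tsum_pos (fun n => (Real.exp_pos _).le) 0 (Real.exp_pos _)
  refine ⟨2 * ∑' n, rKW n, by positivity, 1, one_pos, ?_⟩
  intro t ht ht1 u hu
  constructor
  · have key := rKW_tail
      (fun n : ℤ => -((Real.exp (π / t * (u + 1 / 4 + 2 * n * u - n ^ 2)) : ℝ) : ℂ)) {0}
      (Real.exp (π / t * (u + 1 / 4 + (2 * |u| - 1)))) (by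
        intro n hn
        rw [norm_neg, Complex.norm_real, Real.norm_of_nonneg (Real.exp_pos _).le]
        obtain ⟨h1, h2⟩ := ineqKW1 u hu n (by simpa using hn)
        exact scaleKW t ht ht1 _ _ _ h1 h2) (Real.exp_pos _).le
    have e0 : π / t * (u + 1 / 4 + 2 * ((0 : ℤ) : ℝ) * u - ((0 : ℤ) : ℝ) ^ 2)
        = π * u / t + π / (4 * t) := by
      push_cast; field_simp; ring
    have e1 : Real.exp (π / t * (u + 1 / 4 + (2 * |u| - 1)))
        = Real.exp (π * u / t + π / (4 * t)) * Real.exp ((2 * π * |u| - π) / t) := by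
      rw [← Real.exp_add]; congr 1; field_simp; try ring
    rw [Finset.sum_singleton, e0, sub_neg_eq_add, e1] at key
    unfold jacobiThetaKW
    simp_rw [termKW1 t u ht]
    refine key.trans ?_
    have : 0 ≤ Real.exp (π * u / t + π / (4 * t)) * Real.exp ((2 * π * |u| - π) / t)
      * ∑' n, rKW n := by positivity
    linarith
  · have key := rKW_tail
      (fun n : ℤ => -((Real.exp (π / t * (-1 / 4 + (2 * n + 1) * u - n ^ 2 - n)) : ℝ) : ℂ)) {0, -1}
      (Real.exp (π / t * (-1 / 4 + |u| + (2 * |u| - 1)))) (by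
        intro n hn
        rw [norm_neg, Complex.norm_real, Real.norm_of_nonneg (Real.exp_pos _).le]
        simp only [Finset.mem_insert, Finset.mem_singleton, not_or] at hn
        obtain ⟨h1, h2⟩ := ineqKW2 u hu n hn.1 hn.2
        exact scaleKW t ht ht1 _ _ _ h1 h2) (Real.exp_pos _).le
    have e0 : Real.exp (π / t * (-1 / 4 + (2 * ((0 : ℤ) : ℝ) + 1) * u - ((0 : ℤ) : ℝ) ^ 2
        - ((0 : ℤ) : ℝ))) = Real.exp (-π / (4 * t)) * Real.exp (π * u / t) := by
      rw [← Real.exp_add]; congr 1; push_cast; field_simp; ring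
    have e0' : Real.exp (π / t * (-1 / 4 + (2 * ((-1 : ℤ) : ℝ) + 1) * u - ((-1 : ℤ) : ℝ) ^ 2
        - ((-1 : ℤ) : ℝ))) = Real.exp (-π / (4 * t)) * Real.exp (-(π * u / t)) := by
      rw [← Real.exp_add]; congr 1; push_cast; field_simp; ring
    have e1 : Real.exp (π / t * (-1 / 4 + |u| + (2 * |u| - 1)))
        = Real.exp (-π / (4 * t)) * Real.exp |π * u / t| * Real.exp ((2 * π * |u| - π) / t) := by
      have : |π * u / t| = π * |u| / t := by
        rw [abs_div, abs_mul, abs_of_pos Real.pi_pos, abs_of_pos ht]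
      rw [this, ← Real.exp_add, ← Real.exp_add]; congr 1; field_simp; try ring
    have hc : Real.exp |π * u / t| ≤ 2 * Real.cosh (π * u / t) := by
      rw [← Real.cosh_abs, Real.cosh_eq]
      linarith [Real.exp_pos (-|π * u / t|)]
    rw [Finset.sum_pair (by norm_num), e0, e0', e1] at key
    unfold jacobiThetaKW
    simp_rw [termKW2 t u ht]
    have e2 : (2 * Real.exp (-π / (4 * t)) * Real.cosh (π * u / t) : ℂ)
        = -(-((Real.exp (-π / (4 * t)) * Real.exp (π * u / t) : ℝ) : ℂ) +
          -((Real.exp (-π / (4 * t)) * Real.exp (-(π * u / t)) : ℝ) : ℂ)) := by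
      rw [Real.cosh_eq]; push_cast; ring
    rw [e2, ← sub_eq_add_neg]
    refine key.trans ?_
    calc _ ≤ Real.exp (-π / (4 * t)) * (2 * Real.cosh (π * u / t))
          * Real.exp ((2 * π * |u| - π) / t) * ∑' n, rKW n := by gcongr
      _ = _ := by ring
end

section
/- Fix integers ℓ and m > n ≥ 1. There exist constants C > 0 and t₀ > 0 such that for all 0 < t < t₀: | ∫_{|u| ≥ 1/2} e^{π(n−m)u²/t − 2πiℓu} / cosh(πu/t)^n du | ≤ C t e^{π(n−m)/(4t)}. -/
open Real MeasureTheory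

lemma aux_bound (ℓ : ℤ) (m n : ℕ) (t u : ℝ) (h2 : n < m) (ht : 0 < t) :
    ‖Complex.exp (π * ((n : ℂ) - m) * u ^ 2 / t - 2 * π * Complex.I * ℓ * u) /
              (Real.cosh (π * u / t) : ℂ) ^ n‖ ≤
    Real.exp (π * ((n : ℝ) - m) / (4 * t)) *
      (Real.exp (π * ((m : ℝ) - n) / t / 2) * Real.exp (-(π * ((m : ℝ) - n) / t) * |u|)) := by
  have hk : (0 : ℝ) < (m : ℝ) - n := by
    have : (n : ℝ) < m := by exact_mod_cast h2
    linarith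
  have hre : (π * ((n : ℂ) - m) * u ^ 2 / t - 2 * π * Complex.I * ℓ * u) =
      ((π * ((n : ℝ) - m) * u ^ 2 / t : ℝ) : ℂ) + ((-(2 * π * ℓ * u) : ℝ) : ℂ) * Complex.I := by
    push_cast; ring
  have hc : 1 ≤ Real.cosh (π * u / t) ^ n := one_le_pow₀ (Real.one_le_cosh _)
  rw [norm_div, norm_pow, Complex.norm_real, Real.norm_of_nonneg (Real.cosh_pos _).le, hre,
    Complex.exp_add, norm_mul, Complex.norm_exp_ofReal_mul_I, Complex.norm_exp,
    Complex.ofReal_re, mul_one, ← Real.exp_add, ← Real.exp_add]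
  refine (div_le_self (Real.exp_pos _).le hc).trans (Real.exp_le_exp.2 ?_)
  have hp : 0 ≤ π * ((m : ℝ) - n) / t * (|u| - 1 / 2) ^ 2 := by positivity
  have : π * ((n : ℝ) - m) / (4 * t) + (π * ((m : ℝ) - n) / t / 2 +
      -(π * ((m : ℝ) - n) / t) * |u|) - π * ((n : ℝ) - m) * u ^ 2 / t
      = π * ((m : ℝ) - n) / t * (|u| - 1 / 2) ^ 2 := by
    rw [← sq_abs u]; field_simp; ring
  linarith

lemma aux_int (c : ℝ) (hc : 0 < c) :
    IntegrableOn (fun u : ℝ => Real.exp (-c * |u|)) {u : ℝ | 1 / 2 ≤ |u|} ∧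
    ∫ u in {u : ℝ | 1 / 2 ≤ |u|}, Real.exp (-c * |u|) = 2 * (Real.exp (-(c / 2)) / c) := by
  have hS : {u : ℝ | 1 / 2 ≤ |u|} = Set.Iic (-(1/2)) ∪ Set.Ici (1/2) := by
    ext u; simp only [Set.mem_ofPred_eq, le_abs, Set.mem_union, Set.mem_Iic, Set.mem_Ici]
    constructor <;> rintro (h | h) <;> first | (left; linarith) | (right; linarith)
  have e1 : Set.EqOn (fun u : ℝ => Real.exp (-c * |u|)) (fun u => Real.exp (c * u))
      (Set.Iic (-(1/2))) := by
    intro u hu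
    have : u ≤ 0 := by have := Set.mem_Iic.1 hu; linarith
    simp [abs_of_nonpos this]
  have e2 : Set.EqOn (fun u : ℝ => Real.exp (-c * |u|)) (fun u => Real.exp (-c * u))
      (Set.Ici (1/2)) := by
    intro u hu
    have : 0 ≤ u := by have := Set.mem_Ici.1 hu; linarith
    simp [abs_of_nonneg this]
  have i1 : IntegrableOn (fun u : ℝ => Real.exp (-c * |u|)) (Set.Iic (-(1/2))) :=
    (integrableOn_exp_mul_Iic hc _).congr_fun e1.symm measurableSet_Iic
  have i2 : IntegrableOn (fun u : ℝ => Real.exp (-c * |u|)) (Set.Ici (1/2)) :=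
    (Iff.mpr integrableOn_Ici_iff_integrableOn_Ioi
      (integrableOn_exp_mul_Ioi (by linarith : -c < 0) _)).congr_fun e2.symm measurableSet_Ici
  rw [hS]
  refine ⟨i1.union i2, ?_⟩
  rw [setIntegral_union _ measurableSet_Ici i1 i2, setIntegral_congr_fun measurableSet_Iic e1,
    setIntegral_congr_fun measurableSet_Ici e2, integral_Ici_eq_integral_Ioi,
    integral_exp_mul_Iic hc, integral_exp_mul_Ioi (by linarith : -c < 0)]
  · have a1 : c * -(1/2) = -(c/2) := by ring
    have a2 : -c * (1/2) = -(c/2) := by ring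
    rw [a1, a2]; field_simp; ring
  · rw [Set.disjoint_left]
    intro u h h'
    have := Set.mem_Iic.1 h
    have := Set.mem_Ici.1 h'
    linarith

/-- Fix integers `ℓ` and `m > n ≥ 1`. There exist constants `C > 0` and `t₀ > 0` such that
for all `0 < t < t₀`:
`| ∫_{|u| ≥ 1/2} e^{π(n−m)u²/t − 2πiℓu} / cosh(πu/t)^n du | ≤ C t e^{π(n−m)/(4t)}`. -/
theorem stmt_16 (ℓ : ℤ) (m n : ℕ) (h1 : 1 ≤ n) (h2 : n < m) :
    ∃ C : ℝ, 0 < C ∧ ∃ t₀ : ℝ, 0 < t₀ ∧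
      ∀ t : ℝ, 0 < t → t < t₀ →
        ‖∫ u in {u : ℝ | 1 / 2 ≤ |u|},
            Complex.exp (π * ((n : ℂ) - m) * u ^ 2 / t - 2 * π * Complex.I * ℓ * u) /
              (Real.cosh (π * u / t) : ℂ) ^ n‖
          ≤ C * t * Real.exp (π * ((n : ℝ) - m) / (4 * t)) := by
  have hk : (0 : ℝ) < (m : ℝ) - n := by
    have : (n : ℝ) < m := by exact_mod_cast h2
    linarith
  refine ⟨2 / (π * ((m : ℝ) - n)), by positivity, 1, one_pos, fun t ht _ => ?_⟩
  have hc : 0 < π * ((m : ℝ) - n) / t := by positivity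
  obtain ⟨hi, he⟩ := aux_int _ hc
  refine (norm_integral_le_of_norm_le ((hi.const_mul _).const_mul _)
    (Filter.Eventually.of_forall fun u => aux_bound ℓ m n t u h2 ht)).trans (le_of_eq ?_)
  rw [integral_const_mul, integral_const_mul, he, Real.exp_neg]
  have := Real.exp_pos (π * ((m : ℝ) - n) / t / 2)
  generalize Real.exp (π * ((m : ℝ) - n) / t / 2) = E at *
  field_simp
end

section
/- Let m > n > 0 be even integers and let ℓ be an integer with 0 ≤ ℓ < m − n. Then for all τ ∈ ℍ (with v := Im τ) and all real ε: R_{(m−n)/2, ℓ}(ε; τ) = −i e^{−πi(ℓ − (m−n)/2)² τ/(m−n) + 2πi((m−n)/2 − ℓ)ε} · R( (m−n)ε − ((m−n)/2 − ℓ)τ − 1/2 ; (m−n)τ ). -/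
open Real

/-- `E(x) := 2∫₀^x e^{−πt²} dt`. -/
noncomputable def gaussE (x : ℝ) : ℝ := 2 * ∫ t in (0 : ℝ)..x, Real.exp (-π * t ^ 2)

/-- For `M ∈ ℕ`, `ℓ ∈ ℤ`, `w ∈ ℂ`, `τ ∈ ℍ` (with `v := Im τ`), the nonholomorphic
completion term
`R_{M,ℓ}(w;τ) := ∑_{λ ∈ ℤ, λ ≡ ℓ (mod 2M)} { sgn(λ + 1/2) −
  E((λ + 2M·Im(w)/v)·√(v/M)) } e^{−πiλ²τ/(2M) − 2πiλw}`,
parametrized by `λ = ℓ + 2Mj`, `j ∈ ℤ`. -/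
noncomputable def Rcompletion (M : ℕ) (ℓ : ℤ) (w τ : ℂ) : ℂ :=
  ∑' j : ℤ,
    ((Real.sign ((ℓ : ℝ) + 2 * M * j + 1 / 2) -
        gaussE (((ℓ : ℝ) + 2 * M * j + 2 * M * w.im / τ.im) * Real.sqrt (τ.im / M)) : ℝ) : ℂ) *
      Complex.exp (-π * Complex.I * ((ℓ : ℂ) + 2 * M * j) ^ 2 * τ / (2 * M) -
        2 * π * Complex.I * ((ℓ : ℂ) + 2 * M * j) * w)

/-- Zwegers' function
`R(z;τ) := ∑_{r ∈ 1/2 + ℤ} (sgn(r) − E((r + Im(z)/Im(τ))·√(2 Im τ))) (−1)^{r−1/2}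
  e^{−πir²τ} e^{−2πirz}`, parametrized by `r = j + 1/2`, `j ∈ ℤ`. -/
noncomputable def zwegersR (z τ : ℂ) : ℂ :=
  ∑' j : ℤ,
    ((Real.sign ((j : ℝ) + 1 / 2) -
        gaussE (((j : ℝ) + 1 / 2 + z.im / τ.im) * Real.sqrt (2 * τ.im)) : ℝ) : ℂ) *
      (-1 : ℂ) ^ j *
      Complex.exp (-π * Complex.I * ((j : ℂ) + 1 / 2) ^ 2 * τ) *
      Complex.exp (-2 * π * Complex.I * ((j : ℂ) + 1 / 2) * z)

/-- Let `m > n > 0` be even integers and let `ℓ` be an integer with `0 ≤ ℓ < m − n`. Then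
for all `τ ∈ ℍ` and all real `ε`:
`R_{(m−n)/2, ℓ}(ε; τ) = −i e^{−πi(ℓ − (m−n)/2)² τ/(m−n) + 2πi((m−n)/2 − ℓ)ε} ·
  R((m−n)ε − ((m−n)/2 − ℓ)τ − 1/2; (m−n)τ)`. -/
theorem stmt_18 (m n : ℕ) (hn : 0 < n) (hnm : n < m) (hme : Even m) (hne : Even n)
    (ℓ : ℤ) (hl0 : 0 ≤ ℓ) (hl1 : ℓ < (m : ℤ) - n) (τ : ℂ) (hτ : 0 < τ.im) (ε : ℝ) :
    Rcompletion ((m - n) / 2) ℓ (ε : ℂ) τ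
      = -Complex.I *
          Complex.exp (-π * Complex.I * ((ℓ : ℂ) - ((m : ℂ) - n) / 2) ^ 2 * τ / ((m : ℂ) - n)
              + 2 * π * Complex.I * (((m : ℂ) - n) / 2 - ℓ) * ε) *
          zwegersR (((m : ℂ) - n) * ε - (((m : ℂ) - n) / 2 - ℓ) * τ - 1 / 2)
            (((m : ℂ) - n) * τ) := by
  obtain ⟨M, hM⟩ : ∃ M : ℕ, m = n + 2 * M := by
    obtain ⟨a, ha⟩ := hme
    obtain ⟨b, hb⟩ := hne
    exact ⟨a - b, by omega⟩
  have hMpos : 0 < M := by omega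
  have hdiv : (m - n) / 2 = M := by omega
  have hN : (m : ℂ) - n = 2 * M := by rw [hM]; push_cast; ring
  have hl2 : ℓ < 2 * (M : ℤ) := by rw [hM] at hl1; push_cast at hl1; linarith
  have hMR : (0 : ℝ) < M := by exact_mod_cast hMpos
  have hMC : (M : ℂ) ≠ 0 := by exact_mod_cast hMpos.ne'
  rw [hdiv, hN]
  unfold Rcompletion zwegersR
  rw [← tsum_mul_left]
  refine tsum_congr fun j => ?_
  have hsign : Real.sign ((ℓ : ℝ) + 2 * M * j + 1 / 2) = Real.sign ((j : ℝ) + 1 / 2) := by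
    have hl0' : (0 : ℝ) ≤ ℓ := by exact_mod_cast hl0
    rcases le_or_gt 0 j with hj | hj
    · have hj' : (0 : ℝ) ≤ j := by exact_mod_cast hj
      rw [Real.sign_of_pos (by positivity), Real.sign_of_pos (by positivity)]
    · have hj' : (j : ℝ) ≤ -1 := by exact_mod_cast (by omega : j ≤ -1)
      have h1 : (ℓ : ℝ) ≤ 2 * M - 1 := by exact_mod_cast (by omega : ℓ ≤ 2 * (M : ℤ) - 1)
      rw [Real.sign_of_neg (by nlinarith), Real.sign_of_neg (by linarith)]
  have harg : ((ℓ : ℝ) + 2 * M * j + 2 * M * (ε : ℂ).im / τ.im) * Real.sqrt (τ.im / M)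
      = ((j : ℝ) + 1 / 2 + (2 * (M : ℂ) * ε - (2 * (M : ℂ) / 2 - ℓ) * τ - 1 / 2).im
          / (2 * (M : ℂ) * τ).im) * Real.sqrt (2 * (2 * (M : ℂ) * τ).im) := by
    have e1 : (2 * (M : ℂ) * τ).im = 2 * M * τ.im := by simp
    have e2 : (2 * (M : ℂ) * ε - (2 * (M : ℂ) / 2 - ℓ) * τ - 1 / 2).im
        = -((M : ℝ) - ℓ) * τ.im := by
      rw [show (2 * (M : ℂ) * ε - (2 * (M : ℂ) / 2 - ℓ) * τ - 1 / 2)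
        = ((2 * M * ε - 1 / 2 : ℝ) : ℂ) - ((M - ℓ : ℝ) : ℂ) * τ by push_cast; ring]
      rw [Complex.sub_im, Complex.im_ofReal_mul, Complex.ofReal_im]
      ring
    have e3 : Real.sqrt (2 * (2 * M * τ.im)) = 2 * M * Real.sqrt (τ.im / M) := by
      rw [show 2 * (2 * M * τ.im) = (2 * (M : ℝ)) ^ 2 * (τ.im / M) by field_simp,
        Real.sqrt_mul (by positivity), Real.sqrt_sq (by positivity)]
    rw [e1, e2, e3, Complex.ofReal_im]
    field_simp
    ring
  rw [hsign, harg]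
  have hexp : Complex.exp (-π * Complex.I * ((ℓ : ℂ) + 2 * M * j) ^ 2 * τ / (2 * M) -
        2 * π * Complex.I * ((ℓ : ℂ) + 2 * M * j) * ε)
      = -Complex.I * Complex.exp (-π * Complex.I * ((ℓ : ℂ) - 2 * M / 2) ^ 2 * τ / (2 * M)
              + 2 * π * Complex.I * (2 * M / 2 - ℓ) * ε) * ((-1 : ℂ) ^ j *
      Complex.exp (-π * Complex.I * ((j : ℂ) + 1 / 2) ^ 2 * (2 * M * τ)) *
      Complex.exp (-2 * π * Complex.I * ((j : ℂ) + 1 / 2) *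
        (2 * M * ε - (2 * M / 2 - ℓ) * τ - 1 / 2))) := by
    have h1 : (-1 : ℂ) ^ j = Complex.exp (-(j * (π * Complex.I))) := by
      rw [← mul_neg, Complex.exp_int_mul, Complex.exp_neg, Complex.exp_pi_mul_I]
      norm_num
    have h2 : -Complex.I = Complex.exp (-(π / 2 * Complex.I)) := by
      rw [Complex.exp_neg, Complex.exp_pi_div_two_mul_I, Complex.inv_I]
    rw [h1, h2]
    simp only [← Complex.exp_add]
    congr 1
    field_simp
    ring
  rw [hexp]
  ring
end
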